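/- arXiv:2102.02608 — 2 statements merged into one kernel-verified Lean document; each statement's English description precedes it below -/
import Mathlib

section
/- Let F be a finite field of size q and let k ≥ 2. Fix a bijection F^k ≃ [q^k] and identify each linear functional f : F^k → F with its evaluation vector (f(x))_{x ∈ F^k}. If f_1, …, f_k are linearly independent linear functionals on F^k, then their evaluation vectors are balanced vectors and together form an edge of G_{q,k}. Consequently, any two distinct normalized nonzero linear functionals (functionals whose leading nonzero coefficient equals 1) lie together in some edge of G_{q,k}, so every valid k-coloring of G_{q,k} assigns distinct colors to all (q^k − 1)/(q − 1) normalized nonzero linear functionals. -/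
/-- A vector `u ∈ F^{q^k}` is *balanced* if every symbol of the (size-`q`) alphabet `F`
occurs exactly `q^(k-1)` times among its coordinates. -/
def BalancedVec {F : Type*} [DecidableEq F] (q k : ℕ) (u : Fin (q ^ k) → F) : Prop :=
  ∀ a : F, (Finset.univ.filter fun i => u i = a).card = q ^ (k - 1)

/-- A finite set `s` of vectors in `F^{q^k}` is an edge of the hypergraph `G_{q,k}` if it
consists of `k` balanced vectors and the collection of `k`-tuples obtained by reading off
the coordinates of the vectors of `s` (over all `q^k` positions) is exactly `F^k`,
each tuple occurring once. -/
def IsGEdge {F : Type*} [DecidableEq F] (q k : ℕ) (s : Finset (Fin (q ^ k) → F)) : Prop :=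
  s.card = k ∧ (∀ u ∈ s, BalancedVec q k u) ∧
    Function.Bijective fun (i : Fin (q ^ k)) (u : {x // x ∈ s}) => u.1 i

/-- A nonzero coefficient vector `a ∈ F^k` is *normalized* if its first (leading) nonzero
coefficient equals `1`. -/
def Normalized {k : ℕ} {F : Type*} [Field F] (a : Fin k → F) : Prop :=
  ∃ i : Fin k, a i = 1 ∧ ∀ j : Fin k, j < i → a j = 0

/-- Linearly independent linear functionals, as many as the dimension, separate points. -/
lemma injective_of_linearIndependent_dual {K V ι : Type*} [Field K] [AddCommGroup V] [Module K V]
    [FiniteDimensional K V] [Fintype ι] {f : ι → V →ₗ[K] K} (hf : LinearIndependent K f)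
    (hcard : Fintype.card ι = Module.finrank K V) :
    Function.Injective fun (x : V) (t : ι) => f t x := by
  have hspan : Submodule.span K (Set.range f) = ⊤ :=
    hf.span_eq_top_of_card_eq_finrank' (by rw [hcard]; exact Subspace.dual_finrank_eq.symm)
  intro x y hxy
  rw [← sub_eq_zero, ← Module.forall_dual_apply_eq_zero_iff K]
  intro g
  have hg : g ∈ Submodule.span K (Set.range f) := hspan ▸ Submodule.mem_top
  induction hg using Submodule.span_induction with
  | mem g hg =>
    obtain ⟨t, rfl⟩ := hg
    rw [map_sub, sub_eq_zero]
    exact congrFun hxy t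
  | zero => rfl
  | add g₁ g₂ _ _ h₁ h₂ => rw [LinearMap.add_apply, h₁, h₂, add_zero]
  | smul c g _ h => rw [LinearMap.smul_apply, h, smul_zero]

/-- The number of functions `ι → F` with a prescribed value at one point. -/
lemma card_filter_apply_eq {ι F : Type*} [Fintype ι] [DecidableEq ι] [Fintype F] [DecidableEq F]
    (t : ι) (a : F) :
    (Finset.univ.filter fun x : ι → F => x t = a).card =
      Fintype.card F ^ (Fintype.card ι - 1) := by
  have h : (Finset.univ.filter fun x : ι → F => x t = a) =
      Fintype.piFinset fun s => if s = t then {a} else Finset.univ := by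
    ext x
    simp only [Finset.mem_filter, Finset.mem_univ, true_and, Fintype.mem_piFinset]
    refine ⟨fun hx s => ?_, fun hx => by simpa using hx t⟩
    split_ifs with hs
    · simp [hs, hx]
    · simp
  rw [h, Fintype.card_piFinset, ← Finset.mul_prod_erase _ _ (Finset.mem_univ t),
    Finset.prod_congr rfl (g := fun _ => Fintype.card F)]
  · simp
  · intro s hs
    simp [Finset.ne_of_mem_erase hs]

/-- The coordinates of a bijection from `[q^k]` onto `F^k` are balanced. -/
lemma balancedVec_of_bijective {F : Type*} [Fintype F] [DecidableEq F] {q k : ℕ}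
    (hq : Fintype.card F = q) {e : Fin (q ^ k) → Fin k → F} (he : Function.Bijective e)
    (t : Fin k) : BalancedVec q k fun j => e j t := by
  intro a
  have h := card_filter_apply_eq (F := F) t a
  rw [hq, Fintype.card_fin] at h
  rw [← h]
  refine Finset.card_bijective e he fun j => ?_
  simp

/-- The coordinates of a bijection from `[q^k]` onto `F^k` form an edge, if distinct. -/
lemma isGEdge_of_bijective {F : Type*} [Fintype F] [DecidableEq F] {q k : ℕ}
    (hq : Fintype.card F = q) {e : Fin (q ^ k) → Fin k → F} (he : Function.Bijective e)
    (hinj : Function.Injective fun t j => e j t) :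
    IsGEdge q k ((Finset.univ : Finset (Fin k)).image fun t j => e j t) := by
  have hcard : ((Finset.univ : Finset (Fin k)).image fun t j => e j t).card = k := by
    rw [Finset.card_image_of_injective _ hinj, Finset.card_fin]
  refine ⟨hcard, fun u hu => ?_, ?_⟩
  · obtain ⟨t, -, rfl⟩ := Finset.mem_image.1 hu
    exact balancedVec_of_bijective hq he t
  · rw [Fintype.bijective_iff_injective_and_card]
    refine ⟨fun i j hij => he.1 (funext fun t => ?_), ?_⟩
    · exact congrFun hij ⟨fun j => e j t, Finset.mem_image_of_mem _ (Finset.mem_univ t)⟩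
    · rw [Fintype.card_fun, Fintype.card_coe, hcard, hq, Fintype.card_fin]

/-- Evaluation vectors of `k` linearly independent functionals on `F^k`: the coordinates
of a bijection. -/
lemma bijective_eval_of_linearIndependent {F : Type*} [Field F] [Fintype F] {q k : ℕ}
    (σ : (Fin k → F) ≃ Fin (q ^ k)) {f : Fin k → ((Fin k → F) →ₗ[F] F)}
    (hf : LinearIndependent F f) :
    Function.Bijective fun (j : Fin (q ^ k)) (t : Fin k) => f t (σ.symm j) := by
  have h := injective_of_linearIndependent_dual hf (by simp)
  exact (Finite.injective_iff_bijective.1 h).comp σ.symm.bijective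

/-- Evaluation vectors of `k` linearly independent functionals on `F^k` form an edge. -/
lemma isGEdge_of_linearIndependent {F : Type*} [Field F] [Fintype F] [DecidableEq F] {q k : ℕ}
    (hq : Fintype.card F = q) (σ : (Fin k → F) ≃ Fin (q ^ k))
    {f : Fin k → ((Fin k → F) →ₗ[F] F)} (hf : LinearIndependent F f) :
    IsGEdge q k ((Finset.univ : Finset (Fin k)).image
      fun t => fun j : Fin (q ^ k) => f t (σ.symm j)) := by
  refine isGEdge_of_bijective hq (bijective_eval_of_linearIndependent σ hf) fun s t hst => ?_
  refine hf.injective (LinearMap.ext fun x => ?_)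
  simpa using congrFun hst (σ x)

/-- Distinct normalized vectors are linearly independent. -/
lemma Normalized.linearIndependent_pair {F : Type*} [Field F] {k : ℕ} {a b : Fin k → F}
    (ha : Normalized a) (hb : Normalized b) (hab : a ≠ b) : LinearIndependent F ![a, b] := by
  rw [LinearIndependent.pair_iff]
  intro s t h
  obtain ⟨i, hai, ha⟩ := ha
  obtain ⟨j, hbj, hb⟩ := hb
  have hpt : ∀ l, s * a l + t * b l = 0 := fun l => congrFun h l
  have hi := hpt i
  have hj := hpt j
  rcases lt_trichotomy i j with hij | rfl | hij
  · rw [hb i hij, hai] at hi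
    obtain rfl : s = 0 := by simpa using hi
    simpa [hbj] using hj
  · rw [hai, hbj, mul_one, mul_one] at hi
    obtain rfl : t = -s := by linear_combination hi
    have hs : s = 0 := by
      by_contra hs
      refine hab (funext fun l => mul_left_cancel₀ hs ?_)
      linear_combination hpt l
    simp [hs]
  · rw [ha j hij, hbj] at hj
    obtain rfl : t = 0 := by simpa using hj
    simpa [hai] using hi

/-- A linearly independent pair extends to a basis indexed by `Fin k`, `k` the dimension. -/
lemma exists_basis_mem_range_of_pair {K V : Type*} [Field K] [AddCommGroup V] [Module K V]
    [FiniteDimensional K V] {k : ℕ} (hk : Module.finrank K V = k) {x y : V}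
    (h : LinearIndependent K ![x, y]) :
    ∃ v : Module.Basis (Fin k) K V, x ∈ Set.range v ∧ y ∈ Set.range v := by
  have hs : LinearIndepOn K id (Set.range ![x, y]) := h.linearIndepOn_id
  let B := Module.Basis.extend hs
  have : Fintype (hs.extend (Set.subset_univ _)) := FiniteDimensional.fintypeBasisIndex B
  let e := Fintype.equivFinOfCardEq ((Module.finrank_eq_card_basis B).symm.trans hk)
  have hrange : Set.range ![x, y] ⊆ Set.range (B.reindex e) := by
    rw [Module.Basis.range_reindex, Module.Basis.range_extend]
    exact hs.subset_extend _
  exact ⟨B.reindex e, hrange ⟨0, rfl⟩, hrange ⟨1, rfl⟩⟩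

/-- Evaluation vectors of distinct normalized functionals lie in a common edge. -/
lemma Normalized.exists_isGEdge {F : Type*} [Field F] [Fintype F] [DecidableEq F] {q k : ℕ}
    (hq : Fintype.card F = q) (σ : (Fin k → F) ≃ Fin (q ^ k)) {a b : Fin k → F}
    (ha : Normalized a) (hb : Normalized b) (hab : a ≠ b) :
    ∃ s : Finset (Fin (q ^ k) → F), IsGEdge q k s ∧
      (fun j : Fin (q ^ k) => ∑ t, a t * σ.symm j t) ∈ s ∧
      (fun j : Fin (q ^ k) => ∑ t, b t * σ.symm j t) ∈ s := by
  obtain ⟨v, ⟨i, hi⟩, ⟨j, hj⟩⟩ :=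
    exists_basis_mem_range_of_pair (Module.finrank_fin_fun F) (ha.linearIndependent_pair hb hab)
  have hf := (v.map (dotProductEquiv F (Fin k))).linearIndependent
  refine ⟨_, isGEdge_of_linearIndependent hq σ hf, ?_, ?_⟩
  · refine Finset.mem_image.2 ⟨i, Finset.mem_univ i, ?_⟩
    funext l
    simp [hi, dotProduct]
  · refine Finset.mem_image.2 ⟨j, Finset.mem_univ j, ?_⟩
    funext l
    simp [hj, dotProduct]

/-- over a finite field `F` of size `q` (with `k ≥ 2` and a fixed bijection
`σ : F^k ≃ [q^k]`): (a) the evaluation vectors of `k` linearly independent linear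
functionals on `F^k` are balanced and form an edge of `G_{q,k}`; (b) consequently any two
distinct normalized nonzero linear functionals lie in a common edge of `G_{q,k}`; and
(c) every valid `k`-coloring of `G_{q,k}` assigns distinct colors to the evaluation
vectors of distinct normalized nonzero linear functionals. -/
theorem stmt6 (F : Type*) [Field F] [Fintype F] [DecidableEq F] (q k : ℕ)
    (hq : Fintype.card F = q) (hk : 2 ≤ k)
    (σ : (Fin k → F) ≃ Fin (q ^ k)) :
    (∀ f : Fin k → ((Fin k → F) →ₗ[F] F), LinearIndependent F f →
      (∀ t : Fin k, BalancedVec q k (fun j : Fin (q ^ k) => f t (σ.symm j))) ∧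
      IsGEdge q k ((Finset.univ : Finset (Fin k)).image
        fun t => fun j : Fin (q ^ k) => f t (σ.symm j))) ∧
    (∀ a b : Fin k → F, Normalized a → Normalized b → a ≠ b →
      ∃ s : Finset (Fin (q ^ k) → F), IsGEdge q k s ∧
        (fun j : Fin (q ^ k) => ∑ t, a t * σ.symm j t) ∈ s ∧
        (fun j : Fin (q ^ k) => ∑ t, b t * σ.symm j t) ∈ s) ∧
    (∀ (c : ℕ) (col : (Fin (q ^ k) → F) → Fin c),
      (∀ s : Finset (Fin (q ^ k) → F), IsGEdge q k s → k ≤ (s.image col).card) →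
      ∀ a b : Fin k → F, Normalized a → Normalized b → a ≠ b →
        col (fun j : Fin (q ^ k) => ∑ t, a t * σ.symm j t) ≠
          col (fun j : Fin (q ^ k) => ∑ t, b t * σ.symm j t)) := by
 
  refine ⟨fun f hf => ⟨fun t => ?_, isGEdge_of_linearIndependent hq σ hf⟩,
    fun a b ha hb hab => ha.exists_isGEdge hq σ hb hab, fun c col hcol a b ha hb hab heq => ?_⟩
  · exact balancedVec_of_bijective hq (bijective_eval_of_linearIndependent σ hf) t
  · obtain ⟨s, hs, has, hbs⟩ := ha.exists_isGEdge hq σ hb hab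
    have hinj : Set.InjOn col s :=
      Finset.card_image_iff.1 (le_antisymm Finset.card_image_le (hs.1.le.trans (hcol s hs)))
    have hvec := hinj has hbs heq
    refine hab (dotProduct_eq a b fun x => ?_)
    simpa [dotProduct] using congrFun hvec (σ x)
end

section
/- Let n, k be positive integers with n − k ≥ k, and let G_0 = ([n], E_0) be an erasure hypergraph all of whose edges have size at least k. Set N = 2n − k, let U = {n+1, …, N}, and define the error hypergraph G^err = ([N], E^err) with E^err = {U} ∪ {[n] ∖ e : e ∈ E_0} (each edge viewed as a subset of [N]). Then for every finite alphabet F: there exists an encoding F^k → F^n that is erasure-good for G_0 if and only if there exists an encoding F^k → F^N that is error-good for G^err; moreover, when F is a finite field, the same equivalence holds with both encodings required to be F-linear. Consequently p_k(G^err) = q_k(G_0) and p_{k,lin}(G^err) = q_{k,lin}(G_0). -/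
/-- An encoding `C : F^k → F^n` is *erasure-good* for the hypergraph on `[n]` with
edge set `E` (edges are decoding sets) if for every edge `e ∈ E` the restriction
of codewords to the coordinates in `e` determines the message. -/
def ErasureGood {F : Type*} {k n : ℕ} (E : Finset (Finset (Fin n)))
    (C : (Fin k → F) → (Fin n → F)) : Prop :=
  ∀ e ∈ E, ∀ m₁ m₂ : Fin k → F, (∀ i ∈ e, C m₁ i = C m₂ i) → m₁ = m₂

/-- `overwrite e c v` replaces the coordinates of `c` lying in `e` by the corresponding
coordinates of `v` (the error operation `c ⋄_e v`). -/
def overwrite {F : Type*} {n : ℕ} (e : Finset (Fin n)) (c v : Fin n → F) : Fin n → F :=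
  fun i => if i ∈ e then v i else c i

/-- An encoding `C : F^k → F^n` is *error-good* for the hypergraph on `[n]` with edge set
`E` (edges are error sets) if some decoder `D` recovers every message from every codeword
corrupted on the coordinates of any single edge. -/
def ErrorGood {F : Type*} {k n : ℕ} (E : Finset (Finset (Fin n)))
    (C : (Fin k → F) → (Fin n → F)) : Prop :=
  ∃ D : (Fin n → F) → (Fin k → F),
    ∀ e ∈ E, ∀ m : Fin k → F, ∀ v : Fin n → F, D (overwrite e (C m) v) = m

/-- Given an erasure hypergraph `G₀ = ([n], E₀)`, the error hypergraph
`G^err = ([N], E^err)` on `N = 2n - k` vertices, with edge set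
`E^err = {U} ∪ {[n] ∖ e : e ∈ E₀}` where `U = {n+1, …, N}`. -/
def errEdges {n : ℕ} (k : ℕ) (hkn : k ≤ n) (E₀ : Finset (Finset (Fin n))) :
    Finset (Finset (Fin (2 * n - k))) :=
  insert (Finset.univ.filter fun i : Fin (2 * n - k) => n ≤ i.val)
    (E₀.image fun e => (Finset.univ \ e).image (Fin.castLE (by omega)))

/-- Error-goodness means that distinct messages have codewords which differ somewhere outside
the union of any two error sets. -/
theorem errorGood_iff {F : Type*} {k n : ℕ} (hn : 0 < n) (E : Finset (Finset (Fin n)))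
    (C : (Fin k → F) → (Fin n → F)) :
    ErrorGood E C ↔ ∀ e ∈ E, ∀ f ∈ E, ∀ m₁ m₂ : Fin k → F,
      (∀ i, i ∉ e → i ∉ f → C m₁ i = C m₂ i) → m₁ = m₂ := by
  classical
  constructor
  · rintro ⟨D, hD⟩ e he f hf m₁ m₂ h
    have h₁ := hD e he m₁ (C m₂)
    have h₂ := hD f hf m₂ (overwrite e (C m₁) (C m₂))
    have heq : overwrite f (C m₂) (overwrite e (C m₁) (C m₂)) = overwrite e (C m₁) (C m₂) := by
      funext i
      by_cases hif : i ∈ f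
      · simp [overwrite, hif]
      · by_cases hie : i ∈ e
        · simp [overwrite, hif, hie]
        · simp [overwrite, hif, hie, h i hie hif]
    rw [heq, h₁] at h₂
    exact h₂
  · intro h
    refine ⟨fun y => if hy : ∃ m, ∃ e ∈ E, ∃ v, overwrite e (C m) v = y then hy.choose
      else fun _ => y ⟨0, hn⟩, fun e he m v => ?_⟩
    have hy : ∃ m', ∃ f ∈ E, ∃ w, overwrite f (C m') w = overwrite e (C m) v :=
      ⟨m, e, he, v, rfl⟩
    simp only [dif_pos hy]
    obtain ⟨f, hf, w, hw⟩ := hy.choose_spec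
    refine h f hf e he _ _ fun i hif hie => ?_
    simpa [overwrite, hif, hie] using congrFun hw i

/-- The encoding that repeats the message cyclically. -/
def cyclicEncoding (F : Type*) {k : ℕ} (hk : 0 < k) (n : ℕ) (m : Fin k → F) : Fin n → F :=
  fun i => m ⟨i % k, Nat.mod_lt _ hk⟩

theorem cyclicEncoding_injective (F : Type*) {k n : ℕ} (hk : 0 < k) (hkn : k ≤ n) :
    Function.Injective (cyclicEncoding F hk n) := by
  intro m₁ m₂ h
  funext j
  simpa [cyclicEncoding, Nat.mod_eq_of_lt j.2] using congrFun h ⟨j, j.2.trans_le hkn⟩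

/-- Extends an encoding into `F^n` to one into `F^N` by cyclic repetitions of the message. -/
def appendMessage {F : Type*} {k n : ℕ} (hk : 0 < k) (N : ℕ) (C : (Fin k → F) → (Fin n → F))
    (m : Fin k → F) : Fin N → F :=
  fun i => if h : i.val < n then C m ⟨i, h⟩ else m ⟨(i - n) % k, Nat.mod_lt _ hk⟩

theorem errorGood_appendMessage {F : Type*} {n k : ℕ} (hk : 0 < k) (hn : 0 < n)
    (hkn : k ≤ n) (hnk : k ≤ n - k) {E₀ : Finset (Finset (Fin n))}
    {C : (Fin k → F) → (Fin n → F)} (hC : ErasureGood E₀ C) (hinj : Function.Injective C) :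
    ErrorGood (errEdges k hkn E₀) (appendMessage hk (2 * n - k) C) := by
  rw [errorGood_iff (by omega)]
  have key : ∀ e ∈ E₀, ∀ m₁ m₂ : Fin k → F,
      (∀ i : Fin (2 * n - k), ¬ n ≤ i.val →
        i ∉ (Finset.univ \ e).image (Fin.castLE (by omega : n ≤ 2 * n - k)) →
        appendMessage hk (2 * n - k) C m₁ i = appendMessage hk (2 * n - k) C m₂ i) →
      m₁ = m₂ := by
    intro e he m₁ m₂ h
    refine hC e he m₁ m₂ fun i hi => ?_
    have := h (Fin.castLE (by omega) i) (by simp) (by simpa using hi)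
    simpa [appendMessage] using this
  intro e he f hf m₁ m₂ h
  simp only [errEdges, Finset.mem_insert] at he hf
  rcases he with rfl | he <;> rcases hf with rfl | hf
  · refine hinj (funext fun i => ?_)
    have := h (Fin.castLE (by omega) i) (by simp) (by simp)
    simpa [appendMessage] using this
  · obtain ⟨f', hf', rfl⟩ := Finset.mem_image.1 hf
    exact key f' hf' m₁ m₂ fun i hi hi' => h i (by simpa using hi) hi'
  · obtain ⟨e', he', rfl⟩ := Finset.mem_image.1 he
    exact key e' he' m₁ m₂ fun i hi hi' => h i hi' (by simpa using hi)
  · obtain ⟨e, -, rfl⟩ := Finset.mem_image.1 he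
    obtain ⟨f, -, rfl⟩ := Finset.mem_image.1 hf
    funext j
    have hmem : ∀ s : Finset (Fin n), (⟨n + j, by omega⟩ : Fin (2 * n - k)) ∉
        s.image (Fin.castLE (by omega)) := by
      intro s hs
      obtain ⟨i, -, hi⟩ := Finset.mem_image.1 hs
      have := congrArg Fin.val hi
      simp only [Fin.val_castLE] at this
      omega
    simpa [appendMessage, Nat.mod_eq_of_lt j.2] using h _ (hmem _) (hmem _)

theorem ErrorGood.erasureGood_castLE {F : Type*} {n k : ℕ} (hn : 0 < n) (hkn : k ≤ n)
    {E₀ : Finset (Finset (Fin n))} {C' : (Fin k → F) → (Fin (2 * n - k) → F)}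
    (hC' : ErrorGood (errEdges k hkn E₀) C') :
    ErasureGood E₀ (fun m i => C' m (Fin.castLE (by omega) i)) := by
  rw [errorGood_iff (by omega)] at hC'
  intro e he m₁ m₂ h
  refine hC' _ (Finset.mem_insert_self _ _) _
    (Finset.mem_insert_of_mem (Finset.mem_image_of_mem _ he)) m₁ m₂ fun i hi hi' => ?_
  have hin : i.val < n := by simpa using hi
  refine h ⟨i, hin⟩ ?_
  by_contra hie
  exact hi' (Finset.mem_image.2 ⟨⟨i, hin⟩, by simpa using hie, rfl⟩)

theorem ErasureGood.injective {F : Type*} {n k : ℕ} {E₀ : Finset (Finset (Fin n))}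
    {C : (Fin k → F) → (Fin n → F)} (hC : ErasureGood E₀ C) (hne : E₀.Nonempty) :
    Function.Injective C := by
  obtain ⟨e, he⟩ := hne
  exact fun m₁ m₂ h => hC e he m₁ m₂ fun i _ => congrFun h i

/-- for `n - k ≥ k` and an erasure hypergraph `G₀ = ([n], E₀)` all of whose
edges have size at least `k`, the error hypergraph `G^err` on `N = 2n - k` vertices with
edges `{U} ∪ {[n] ∖ e : e ∈ E₀}` satisfies: for every finite alphabet `F`, an
erasure-good encoding `F^k → F^n` for `G₀` exists iff an error-good encoding `F^k → F^N`
for `G^err` exists; and for every finite field `F` the same equivalence holds for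
`F`-linear encodings. Consequently `p_k(G^err) = q_k(G₀)` and
`p_{k,lin}(G^err) = q_{k,lin}(G₀)`. -/
theorem stmt13 {n k : ℕ} (hk : 0 < k) (hn : 0 < n) (hnk : k ≤ n - k)
    (E₀ : Finset (Finset (Fin n))) (hE₀ : ∀ e ∈ E₀, k ≤ e.card) :
    (∀ (F : Type) [Fintype F],
      (∃ C : (Fin k → F) → (Fin n → F), ErasureGood E₀ C) ↔
      (∃ C' : (Fin k → F) → (Fin (2 * n - k) → F), ErrorGood (errEdges k (by omega) E₀) C')) ∧
    (∀ (F : Type) [Field F] [Fintype F],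
      (∃ C : (Fin k → F) →ₗ[F] (Fin n → F), ErasureGood E₀ (fun m => C m)) ↔
      (∃ C' : (Fin k → F) →ₗ[F] (Fin (2 * n - k) → F),
        ErrorGood (errEdges k (by omega) E₀) (fun m => C' m))) := by
  have hkn : k ≤ n := by omega
  refine ⟨fun F _ => ⟨?_, fun ⟨_, hC'⟩ => ⟨_, hC'.erasureGood_castLE hn hkn⟩⟩,
    fun F _ _ => ⟨?_, fun ⟨C', hC'⟩ =>
      ⟨LinearMap.funLeft F F (Fin.castLE (by omega)) ∘ₗ C', hC'.erasureGood_castLE hn hkn⟩⟩⟩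
  · rintro ⟨C, hC⟩
    obtain ⟨C, hC, hinj⟩ : ∃ C : (Fin k → F) → (Fin n → F),
        ErasureGood E₀ C ∧ Function.Injective C := by
      rcases E₀.eq_empty_or_nonempty with rfl | hne
      · exact ⟨_, by simp [ErasureGood], cyclicEncoding_injective F hk hkn⟩
      · exact ⟨C, hC, hC.injective hne⟩
    exact ⟨_, errorGood_appendMessage hk hn hkn hnk hC hinj⟩
  · rintro ⟨C, hC⟩
    obtain ⟨C, hC, hinj⟩ : ∃ C : (Fin k → F) →ₗ[F] (Fin n → F),
        ErasureGood E₀ (fun m => C m) ∧ Function.Injective C := by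
      rcases E₀.eq_empty_or_nonempty with rfl | hne
      · exact ⟨LinearMap.funLeft F F fun i : Fin n => ⟨i % k, Nat.mod_lt _ hk⟩,
          by simp [ErasureGood], cyclicEncoding_injective F hk hkn⟩
      · exact ⟨C, hC, hC.injective hne⟩
    refine ⟨{ toFun := appendMessage hk (2 * n - k) C
              map_add' := fun x y => ?_
              map_smul' := fun c x => ?_ }, errorGood_appendMessage hk hn hkn hnk hC hinj⟩
    all_goals
      funext i
      by_cases h : i.val < n <;> simp [appendMessage, h]
end
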